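/- Let a, b, c > 0 and τ ∈ ℕ with τ ≥ 1, set β = (1+b)^τ, suppose a > b·β and c·z₊ ≤ 1, where z₊ is the unique positive equilibrium. Let (z_t)_{t≥0} be a solution of the delay recurrence z_{t+1} = H(z_t, z_{t−τ+1}) with nonnegative initial conditions. If z_i ≤ z₊ for all i ∈ {0, …, τ−1}, then z_t ≤ z₊ for all t ≥ 0; if z_i ≥ z₊ for all i ∈ {0, …, τ−1}, then z_t ≥ z₊ for all t ≥ 0. -/

import Mathlib

/-- `Hfun a b c β u v = (1/m(u)) * (u + a·b·v/M(v))` where `m(x) = 1+b+cx` and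
`M(x) = bβ + (β-1)cx`. -/
noncomputable def Hfun (a b c β u v : ℝ) : ℝ :=
  (1 / (1 + b + c * u)) * (u + a * b * v / (b * β + (β - 1) * c * v))

/-- The positive equilibrium `z₊` of the delayed Beverton–Holt recurrence. -/
noncomputable def zplus (a b c β : ℝ) : ℝ :=
  (-(b * (2 * β - 1)) +
      Real.sqrt ((b * (2 * β - 1)) ^ 2 + 4 * b * (a - b * β) * (β - 1))) /
    (2 * c * (β - 1))

theorem zplus_spec (a b c β : ℝ) (hb : 0 < b) (hc : 0 < c) (hβ : 1 < β) (hab : b * β < a) :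
    0 < zplus a b c β ∧
    (b + c * zplus a b c β) * (b * β + (β - 1) * c * zplus a b c β) = a * b := by
  have hβ' : 0 < β - 1 := by linarith
  have hK : 0 < 4 * b * (a - b * β) * (β - 1) := by
    have : 0 < a - b * β := by linarith
    positivity
  have hB : 0 < b * (2 * β - 1) := mul_pos hb (by linarith)
  set D := (b * (2 * β - 1)) ^ 2 + 4 * b * (a - b * β) * (β - 1) with hD
  have hs : Real.sqrt D ^ 2 = D := Real.sq_sqrt (by positivity)
  have hlt : b * (2 * β - 1) < Real.sqrt D := by
    apply Real.lt_sqrt_of_sq_lt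
    linarith
  have hz : 2 * (β - 1) * (c * zplus a b c β) = -(b * (2 * β - 1)) + Real.sqrt D := by
    unfold zplus
    rw [← hD]
    field_simp
  refine ⟨?_, ?_⟩
  · unfold zplus
    rw [← hD]
    apply div_pos (by linarith) (by positivity)
  · set p := zplus a b c β
    have h1 : Real.sqrt D = 2 * (β - 1) * (c * p) + b * (2 * β - 1) := by linarith
    rw [h1, hD] at hs
    have h2 : 4 * (β - 1) * ((b + c * p) * (b * β + (β - 1) * c * p) - a * b) = 0 := by
      linear_combination hs
    have h3 := (mul_eq_zero.mp h2).resolve_left (by positivity)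
    linarith

theorem Hfun_bounds (a b c β p u v : ℝ) (ha : 0 < a) (hb : 0 < b) (hc : 0 < c) (hβ : 1 < β)
    (hp : 0 < p) (he : (b + c * p) * (b * β + (β - 1) * c * p) = a * b) (hcp : c * p ≤ 1)
    (hu : 0 ≤ u) (hv : 0 ≤ v) :
    0 ≤ Hfun a b c β u v ∧ (u ≤ p → v ≤ p → Hfun a b c β u v ≤ p) ∧
      (p ≤ u → p ≤ v → p ≤ Hfun a b c β u v) := by
  have hβ' : 0 < β - 1 := by linarith
  have hβ0 : 0 < β := by linarith
  have hM : 0 < b * β + (β - 1) * c * v := by positivity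
  have hm : 0 < 1 + b + c * u := by positivity
  have hk : 0 < (b + c * p) * (b * β) := by positivity
  have hH : Hfun a b c β u v =
      (u + a * b * v / (b * β + (β - 1) * c * v)) / (1 + b + c * u) := by
    unfold Hfun
    ring
  rw [hH]
  refine ⟨by positivity, fun h1 h2 => ?_, fun h1 h2 => ?_⟩
  · have hF : a * b * v / (b * β + (β - 1) * c * v) ≤ p * (b + c * p) := by
      rw [div_le_iff₀ hM, ← he]
      nlinarith [mul_nonneg hk.le (sub_nonneg.2 h2)]
    rw [div_le_iff₀ hm]
    nlinarith [mul_nonneg (sub_nonneg.2 hcp) (sub_nonneg.2 h1)]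
  · have hF : p * (b + c * p) ≤ a * b * v / (b * β + (β - 1) * c * v) := by
      rw [le_div_iff₀ hM, ← he]
      nlinarith [mul_nonneg hk.le (sub_nonneg.2 h2)]
    rw [le_div_iff₀ hm]
    nlinarith [mul_nonneg (sub_nonneg.2 hcp) (sub_nonneg.2 h1)]

/-- Invariance of `{z ≤ z₊}` and `{z ≥ z₊}`: if `a > b·β` and `c·z₊ ≤ 1`, then
solutions whose initial conditions all lie below (resp. above) the positive
equilibrium `z₊` stay below (resp. above) `z₊` for all time. -/
theorem stmt12 (a b c : ℝ) (ha : 0 < a) (hb : 0 < b) (hc : 0 < c)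
    (τ : ℕ) (hτ : 1 ≤ τ) (hab : b * (1 + b) ^ τ < a)
    (hcz : c * zplus a b c ((1 + b) ^ τ) ≤ 1)
    (z : ℕ → ℝ) (hinit : ∀ i, i < τ → 0 ≤ z i)
    (hrec : ∀ t, z (t + τ) = Hfun a b c ((1 + b) ^ τ) (z (t + τ - 1)) (z t)) :
    ((∀ i, i < τ → z i ≤ zplus a b c ((1 + b) ^ τ)) →
      ∀ t, z t ≤ zplus a b c ((1 + b) ^ τ)) ∧
    ((∀ i, i < τ → zplus a b c ((1 + b) ^ τ) ≤ z i) →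
      ∀ t, zplus a b c ((1 + b) ^ τ) ≤ z t) := by
  have hβ : 1 < (1 + b) ^ τ := one_lt_pow₀ (by linarith) (by omega)
  obtain ⟨hp, he⟩ := zplus_spec a b c _ hb hc hβ hab
  generalize zplus a b c ((1 + b) ^ τ) = p at *
  have key := fun u v => Hfun_bounds a b c _ p u v ha hb hc hβ hp he hcz
  have ind : ∀ P : ℕ → Prop, (∀ i, i < τ → P i) →
      (∀ t, P (t + τ - 1) → P t → P (t + τ)) → ∀ t, P t := by
    intro P h0 hs t
    induction t using Nat.strong_induction_on with
    | _ t ih =>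
      by_cases h : t < τ
      · exact h0 t h
      · obtain ⟨s, rfl⟩ : ∃ s, t = s + τ := ⟨t - τ, by omega⟩
        exact hs s (ih _ (by omega)) (ih _ (by omega))
  have hnn : ∀ t, 0 ≤ z t := ind _ hinit fun t h1 h2 => by
    rw [hrec]
    exact (key _ _ h1 h2).1
  refine ⟨fun h => ind _ h fun t h1 h2 => ?_, fun h => ind _ h fun t h1 h2 => ?_⟩
  · rw [hrec]
    exact (key _ _ (hnn _) (hnn _)).2.1 h1 h2
  · rw [hrec]
    exact (key _ _ (hnn _) (hnn _)).2.2 h1 h2
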